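/- arXiv:1911.12892 — 5 statements merged into one kernel-verified Lean document; each statement's English description precedes it below -/
import Mathlib

section
/- Suppose θ* > π/6 and c > 0 satisfies c² ≤ (π²/(θ1 − θ0)²) · (4 sin²θ* − 1)/(4 − sin²θ*). Let Λ' ∈ ℝ be such that there is a twice continuously differentiable h' : [θ0,θ1] → ℝ with h'(θ0) = h'(θ1) = 0 solving h'' + Λ' (csc θ)² h' = c² h', having exactly one zero in (θ0, θ1) (positive before it, negative after it); and let Λ ∈ ℝ be such that there is a twice continuously differentiable h : [θ0,θ1] → ℝ with h > 0 on (θ0,θ1), h(θ0) = h(θ1) = 0, solving h'' + Λ (csc θ)² h = 4c² h. Then Λ' ≥ Λ. (That is, λ2^{c²} ≥ λ1^{4c²}, so the second Dirichlet eigenvalue of the Laplacian on Ω_{c,θ0,θ1} is λ1^{4c²}.) -/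
open Real Set

/-- Comparison with `sin (π (θ - a) / (b - a))`: the Wronskian vanishes at both end points, so
Rolle's theorem determines the eigenvalue up to the location of an interior point. -/
lemma exists_eigenvalue_eq {a b lam μ : ℝ} (hab : a < b) {u : ℝ → ℝ} (hu : ContDiff ℝ 2 u)
    (ha : u a = 0) (hb : u b = 0) (hne : ∀ θ ∈ Ioo a b, u θ ≠ 0)
    (hsin : ∀ θ ∈ Ioo a b, sin θ ≠ 0)
    (hode : ∀ θ ∈ Ioo a b, deriv (deriv u) θ + lam * ((sin θ)⁻¹) ^ 2 * u θ = μ * u θ) :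
    ∃ ξ ∈ Ioo a b, lam = sin ξ ^ 2 * (μ + π ^ 2 / (b - a) ^ 2) := by
  have hba : 0 < b - a := sub_pos.2 hab
  set k := π / (b - a) with hk
  have hkpos : 0 < k := div_pos pi_pos hba
  have hkb : k * (b - a) = π := by rw [hk]; field_simp
  have hu1 : ∀ x, HasDerivAt u (deriv u x) x := fun x =>
    (hu.differentiable (by norm_num) x).hasDerivAt
  have hu2 : ∀ x, HasDerivAt (deriv u) (deriv (deriv u) x) x := fun x =>
    ((((contDiff_succ_iff_deriv (n := 1)).1 hu).2.2).differentiable (by norm_num) x).hasDerivAt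
  have hlin : ∀ x, HasDerivAt (fun y => k * (y - a)) k x := fun x => by
    simpa using ((hasDerivAt_id x).sub_const a).const_mul k
  have hW : ∀ x, HasDerivAt
      (fun y => deriv u y * sin (k * (y - a)) - u y * (k * cos (k * (y - a))))
      ((deriv (deriv u) x + k ^ 2 * u x) * sin (k * (x - a))) x := fun x => by
    refine (((hu2 x).mul (hlin x).sin).sub
      ((hu1 x).mul ((hlin x).cos.const_mul k))).congr_deriv ?_
    ring
  obtain ⟨ξ, hξ, h0⟩ := exists_hasDerivAt_eq_zero hab
    (fun x _ => (hW x).continuousAt.continuousWithinAt)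
    (by simp [ha, hb, hkb]) (fun x _ => hW x)
  refine ⟨ξ, hξ, ?_⟩
  have hsk : sin (k * (ξ - a)) ≠ 0 := by
    refine (sin_pos_of_pos_of_lt_pi (mul_pos hkpos (sub_pos.2 hξ.1)) ?_).ne'
    rw [← hkb]
    exact mul_lt_mul_of_pos_left (by linarith [hξ.2]) hkpos
  have h1 := (mul_eq_zero.1 h0).resolve_right hsk
  have h2 : (μ + k ^ 2 - lam * ((sin ξ)⁻¹) ^ 2) * u ξ = 0 := by
    linear_combination h1 - hode ξ hξ
  have h3 := (mul_eq_zero.1 h2).resolve_right (hne ξ hξ)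
  have hs := hsin ξ hξ
  rw [← div_pow, ← hk]
  field_simp at h3
  linarith

lemma sin_le_sin_of_mem_Icc_pi_sub {t θ : ℝ} (ht : -(π / 2) ≤ t) (hθ : θ ∈ Icc t (π - t)) :
    sin t ≤ sin θ := by
  rcases le_total θ (π / 2) with h | h
  · exact sin_le_sin_of_le_of_le_pi_div_two ht h hθ.1
  · rw [← sin_pi_sub θ]
    exact sin_le_sin_of_le_of_le_pi_div_two ht (by linarith) (by linarith [hθ.2])

theorem second_eigenvalue_is_lambda1_4c2
    (θ0 θ1 : ℝ) (hθ0 : θ0 ∈ Ioo 0 (π / 2)) (hθ1 : θ1 ∈ Ioo (π / 2) π)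
    (hstar : min θ0 (π - θ1) > π / 6)
    (c : ℝ) (hc : 0 < c)
    (hcbound : c ^ 2 ≤ π ^ 2 / (θ1 - θ0) ^ 2 *
      (4 * Real.sin (min θ0 (π - θ1)) ^ 2 - 1) / (4 - Real.sin (min θ0 (π - θ1)) ^ 2))
    (Lam' Lam : ℝ)
    -- `Λ' = λ₂^{c²}`: eigenvalue with an eigenfunction having exactly one interior sign change
    (h' : ℝ → ℝ) (hC' : ContDiff ℝ 2 h')
    (hb0' : h' θ0 = 0) (hb1' : h' θ1 = 0)
    (hode' : ∀ θ ∈ Icc θ0 θ1,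
      deriv (deriv h') θ + Lam' * ((Real.sin θ)⁻¹) ^ 2 * h' θ = c ^ 2 * h' θ)
    (θ2 : ℝ) (hθ2 : θ2 ∈ Ioo θ0 θ1) (hz : h' θ2 = 0)
    (hposl : ∀ θ ∈ Ioo θ0 θ2, 0 < h' θ)
    (hnegr : ∀ θ ∈ Ioo θ2 θ1, h' θ < 0)
    -- `Λ = λ₁^{4c²}`: eigenvalue with a positive eigenfunction
    (h : ℝ → ℝ) (hC : ContDiff ℝ 2 h)
    (hpos : ∀ θ ∈ Ioo θ0 θ1, 0 < h θ)
    (hb0 : h θ0 = 0) (hb1 : h θ1 = 0)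
    (hode : ∀ θ ∈ Icc θ0 θ1,
      deriv (deriv h) θ + Lam * ((Real.sin θ)⁻¹) ^ 2 * h θ = 4 * c ^ 2 * h θ) :
    Lam' ≥ Lam := by
  set t := min θ0 (π - θ1) with ht
  have htpos : 0 < t := lt_trans (by positivity) hstar
  have ht0 : t ≤ θ0 := min_le_left _ _
  have ht1 : t ≤ π - θ1 := min_le_right _ _
  have hsin_pos : ∀ θ ∈ Icc θ0 θ1, 0 < sin θ := fun θ hθ =>
    sin_pos_of_pos_of_lt_pi (by linarith [hθ.1]) (by linarith [hθ.2])
  have hst : 0 ≤ sin t := sin_nonneg_of_nonneg_of_le_pi htpos.le (by linarith [hθ0.2, pi_pos])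
  have hst1 : sin t ≤ 1 := sin_le_one t
  obtain ⟨hl, hr⟩ := hθ2
  have hlt : θ0 < θ1 := hl.trans hr
  obtain ⟨ξ, hξ, hLam⟩ := exists_eigenvalue_eq hlt hC hb0 hb1 (fun θ hθ => (hpos θ hθ).ne')
    (fun θ hθ => (hsin_pos θ (Ioo_subset_Icc_self hθ)).ne')
    (fun θ hθ => hode θ (Ioo_subset_Icc_self hθ))
  have hupper : Lam ≤ 4 * c ^ 2 + π ^ 2 / (θ1 - θ0) ^ 2 := by
    rw [hLam]
    exact mul_le_of_le_one_left (by positivity) (sin_sq_le_one ξ)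
  have hlower : ∀ a b, θ0 ≤ a → a < b → b ≤ θ1 → b - a ≤ (θ1 - θ0) / 2 → h' a = 0 → h' b = 0 →
      (∀ θ ∈ Ioo a b, h' θ ≠ 0) →
      sin t ^ 2 * (c ^ 2 + 4 * (π ^ 2 / (θ1 - θ0) ^ 2)) ≤ Lam' := by
    intro a b ha hab hb hlen hza hzb hne
    have hsub : ∀ θ ∈ Ioo a b, θ ∈ Icc θ0 θ1 := fun θ hθ =>
      ⟨ha.trans hθ.1.le, hθ.2.le.trans hb⟩
    obtain ⟨η, hη, hLam'⟩ := exists_eigenvalue_eq hab hC' hza hzb hne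
      (fun θ hθ => (hsin_pos θ (hsub θ hθ)).ne') (fun θ hθ => hode' θ (hsub θ hθ))
    rw [hLam']
    have hsη : sin t ≤ sin η := sin_le_sin_of_mem_Icc_pi_sub (by linarith [pi_pos])
      ⟨by linarith [(hsub η hη).1], by linarith [(hsub η hη).2]⟩
    have hba : 0 < b - a := sub_pos.2 hab
    have hfrac : 4 * (π ^ 2 / (θ1 - θ0) ^ 2) ≤ π ^ 2 / (b - a) ^ 2 := by
      calc 4 * (π ^ 2 / (θ1 - θ0) ^ 2) = π ^ 2 / ((θ1 - θ0) / 2) ^ 2 := by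
            have : θ1 - θ0 ≠ 0 := (sub_pos.2 hlt).ne'
            field_simp
            norm_num
        _ ≤ π ^ 2 / (b - a) ^ 2 := by gcongr
    gcongr
  have hLam'_ge : sin t ^ 2 * (c ^ 2 + 4 * (π ^ 2 / (θ1 - θ0) ^ 2)) ≤ Lam' := by
    rcases le_total (θ2 - θ0) ((θ1 - θ0) / 2) with hle | hle
    · exact hlower θ0 θ2 le_rfl hl hr.le hle hb0' hz fun θ hθ => (hposl θ hθ).ne'
    · exact hlower θ2 θ1 hl.le hr le_rfl (by linarith) hz hb1' fun θ hθ => (hnegr θ hθ).ne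
  rw [le_div_iff₀ (by nlinarith)] at hcbound
  linarith
end

section
/- Let c > 0 and let λ, Λ ∈ ℝ be such that there exist twice continuously differentiable functions h1, h2 : [θ0, θ1] → ℝ with h1 > 0 and h2 > 0 on (θ0, θ1), h1(θ0) = h1(θ1) = h2(θ0) = h2(θ1) = 0, satisfying h1'' + (λ (csc θ)² − c²) h1 = 0 and h2'' + (Λ (csc θ)² − 4c²) h2 = 0 on [θ0, θ1]. Then 3 c² sin²θ* < Λ − λ < 3 c². -/
open Real Set

theorem hasDerivAt_wronskian {f g : ℝ → ℝ} (hf : ContDiff ℝ 2 f) (hg : ContDiff ℝ 2 g) (x : ℝ) :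
    HasDerivAt (fun t => deriv f t * g t - f t * deriv g t)
      (deriv (deriv f) x * g x - f x * deriv (deriv g) x) x := by
  have first {u : ℝ → ℝ} (hu : ContDiff ℝ 2 u) : HasDerivAt u (deriv u x) x :=
    (hu.differentiable (by norm_num) x).hasDerivAt
  have second {u : ℝ → ℝ} (hu : ContDiff ℝ 2 u) :
      HasDerivAt (deriv u) (deriv (deriv u) x) x :=
    (((contDiff_succ_iff_deriv (n := 1)).1 hu).2.2.differentiable (by norm_num) x).hasDerivAt
  exact (((second hf).mul (first hg)).sub ((first hf).mul (second hg))).congr_deriv (by ring)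

theorem sin_min_lt_sin {a b x : ℝ} (ha : 0 < a) (hb : b < π) (hx : x ∈ Ioo a b) :
    sin (min a (π - b)) < sin x := by
  have hm : 0 < min a (π - b) := lt_min ha (by linarith)
  have hma := min_le_left a (π - b)
  have hmb := min_le_right a (π - b)
  rcases le_total x (π / 2) with h | h
  · exact sin_lt_sin_of_lt_of_le_pi_div_two (by linarith [pi_pos]) h (by linarith [hx.1])
  · rw [← sin_pi_sub x]
    exact sin_lt_sin_of_lt_of_le_pi_div_two (by linarith [pi_pos]) (by linarith)
      (by linarith [hx.2])

theorem sin_lt_one_of_ne_pi_div_two {x : ℝ} (h0 : 0 < x) (hpi : x < π) (hx : x ≠ π / 2) :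
    sin x < 1 := by
  rcases lt_or_gt_of_ne hx with h | h
  · simpa using sin_lt_sin_of_lt_of_le_pi_div_two (by linarith) le_rfl h
  · rw [← sin_pi_sub x]
    simpa using sin_lt_sin_of_lt_of_le_pi_div_two (x := π - x) (by linarith) le_rfl (by linarith)

theorem rough_fundamental_gap_estimate
    (θ0 θ1 : ℝ) (hθ0 : θ0 ∈ Ioo 0 (π / 2)) (hθ1 : θ1 ∈ Ioo (π / 2) π)
    (c : ℝ) (hc : 0 < c) (lam Lam : ℝ)
    (h1 h2 : ℝ → ℝ) (hC1 : ContDiff ℝ 2 h1) (hC2 : ContDiff ℝ 2 h2)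
    (hpos1 : ∀ θ ∈ Ioo θ0 θ1, 0 < h1 θ) (hpos2 : ∀ θ ∈ Ioo θ0 θ1, 0 < h2 θ)
    (hb10 : h1 θ0 = 0) (hb11 : h1 θ1 = 0) (hb20 : h2 θ0 = 0) (hb21 : h2 θ1 = 0)
    (hode1 : ∀ θ ∈ Icc θ0 θ1,
      deriv (deriv h1) θ + (lam * ((Real.sin θ)⁻¹) ^ 2 - c ^ 2) * h1 θ = 0)
    (hode2 : ∀ θ ∈ Icc θ0 θ1,
      deriv (deriv h2) θ + (Lam * ((Real.sin θ)⁻¹) ^ 2 - 4 * c ^ 2) * h2 θ = 0) :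
    3 * c ^ 2 * Real.sin (min θ0 (π - θ1)) ^ 2 < Lam - lam ∧ Lam - lam < 3 * c ^ 2 := by
  obtain ⟨h0, h0'⟩ := hθ0
  obtain ⟨h1', h1pi⟩ := hθ1
  have hsin : ∀ θ ∈ Ioo θ0 θ1, 0 < sin θ := fun θ hθ =>
    sin_pos_of_pos_of_lt_pi (h0.trans hθ.1) (hθ.2.trans h1pi)
  let W : ℝ → ℝ := fun t => deriv h1 t * h2 t - h1 t * deriv h2 t
  have hW := hasDerivAt_wronskian hC1 hC2
  have hWc : Continuous W := continuous_iff_continuousAt.2 fun x => (hW x).continuousAt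
  have hW0 : W θ0 = 0 := by simp [W, hb10, hb20]
  have hW1 : W θ1 = 0 := by simp [W, hb11, hb21]
  have hderiv : ∀ θ ∈ Ioo θ0 θ1,
      deriv W θ = ((Lam - lam) - 3 * c ^ 2 * sin θ ^ 2) * ((sin θ)⁻¹ ^ 2 * (h1 θ * h2 θ)) := by
    intro θ hθ
    have hs : sin θ ^ 2 * (sin θ)⁻¹ ^ 2 = 1 := by
      have := (hsin θ hθ).ne'
      field_simp
    rw [(hW θ).deriv]
    linear_combination h2 θ * hode1 θ (Ioo_subset_Icc_self hθ) -
      h1 θ * hode2 θ (Ioo_subset_Icc_self hθ) + 3 * c ^ 2 * h1 θ * h2 θ * hs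
  have hweight : ∀ θ ∈ Ioo θ0 θ1, 0 < (sin θ)⁻¹ ^ 2 * (h1 θ * h2 θ) := fun θ hθ =>
    mul_pos (pow_pos (inv_pos.2 (hsin θ hθ)) 2) (mul_pos (hpos1 θ hθ) (hpos2 θ hθ))
  have hc2 : 0 < 3 * c ^ 2 := by positivity
  constructor
  · obtain ⟨θ, hθ, hz⟩ := exists_deriv_eq_zero (h0'.trans h1') hWc.continuousOn
      (hW0.trans hW1.symm)
    rw [hderiv θ hθ] at hz
    have hgap := (mul_eq_zero.1 hz).resolve_right (hweight θ hθ).ne'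
    have hm : 0 ≤ sin (min θ0 (π - θ1)) :=
      sin_nonneg_of_nonneg_of_le_pi (le_min h0.le (by linarith))
        ((min_le_left _ _).trans (by linarith))
    have hlt := pow_lt_pow_left₀ (sin_min_lt_sin h0 h1pi hθ) hm two_ne_zero
    linarith [mul_lt_mul_of_pos_left hlt hc2]
  · by_contra! hge
    have hderiv_pos : ∀ θ ∈ Ioo θ0 θ1, θ ≠ π / 2 → 0 < deriv W θ := by
      intro θ hθ hne
      rw [hderiv θ hθ]
      refine mul_pos ?_ (hweight θ hθ)
      have hlt := pow_lt_one₀ (hsin θ hθ).le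
        (sin_lt_one_of_ne_pi_div_two (h0.trans hθ.1) (hθ.2.trans h1pi) hne) two_ne_zero
      linarith [mul_lt_mul_of_pos_left hlt hc2]
    have hleft : StrictMonoOn W (Icc θ0 (π / 2)) :=
      strictMonoOn_of_deriv_pos (convex_Icc _ _) hWc.continuousOn fun θ hθ => by
        rw [interior_Icc] at hθ
        exact hderiv_pos θ ⟨hθ.1, hθ.2.trans h1'⟩ hθ.2.ne
    have hright : StrictMonoOn W (Icc (π / 2) θ1) :=
      strictMonoOn_of_deriv_pos (convex_Icc _ _) hWc.continuousOn fun θ hθ => by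
        rw [interior_Icc] at hθ
        exact hderiv_pos θ ⟨h0'.trans hθ.1, hθ.2⟩ hθ.1.ne'
    have hl := hleft (left_mem_Icc.2 h0'.le) (right_mem_Icc.2 h0'.le) h0'
    have hr := hright (left_mem_Icc.2 h1'.le) (right_mem_Icc.2 h1'.le) h1'
    linarith
end

section
/- Let P = (cos θ0, sin θ0), Q = e^{π/c}(cos θ0, sin θ0), R = e^{π/c}(cos θ1, sin θ1), S = (cos θ1, sin θ1) be the four corners of Ω_{c,θ0,θ1}. Then the diameter of Ω_{c,θ0,θ1} with respect to the hyperbolic distance equals max { dist(P,Q), dist(P,R), dist(R,S) }. -/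
open Real Set

/-- Hyperbolic distance in the Poincaré upper half-plane:
`cosh (dist p q) = 1 + ((x₂-x₁)² + (y₂-y₁)²)/(2 y₁ y₂)`. -/
noncomputable def hDist (p q : ℝ × ℝ) : ℝ :=
  Real.log ((1 + ((q.1 - p.1) ^ 2 + (q.2 - p.2) ^ 2) / (2 * p.2 * q.2)) +
    Real.sqrt ((1 + ((q.1 - p.1) ^ 2 + (q.2 - p.2) ^ 2) / (2 * p.2 * q.2)) ^ 2 - 1))

/-- Diameter of a set with respect to the hyperbolic distance. -/
noncomputable def hDiam (S : Set (ℝ × ℝ)) : ℝ :=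
  sSup {d : ℝ | ∃ p ∈ S, ∃ q ∈ S, d = hDist p q}

/-- The domain `Ω_{c,θ0,θ1}` in polar coordinates. -/
def Omega (c θ0 θ1 : ℝ) : Set (ℝ × ℝ) :=
  {p | ∃ r θ : ℝ, 1 < r ∧ r < Real.exp (π / c) ∧ θ0 < θ ∧ θ < θ1 ∧
    p = (r * Real.cos θ, r * Real.sin θ)}

/-- The hyperbolic cosine of the hyperbolic distance between the points with polar coordinates
`(r, a)` and `(s, b)`. -/
noncomputable def coshPolarDist (r a s b : ℝ) : ℝ :=
  ((r / s + s / r) / 2 - cos a * cos b) / (sin a * sin b)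

section Polar

variable {r a s b : ℝ}

theorem coshPolarDist_eq (hr : 0 < r) (hs : 0 < s) (ha : 0 < sin a) (hb : 0 < sin b) :
    coshPolarDist r a s b = 1 + ((s * cos b - r * cos a) ^ 2 + (s * sin b - r * sin a) ^ 2) /
      (2 * (r * sin a) * (s * sin b)) := by
  unfold coshPolarDist
  field_simp
  linear_combination (-r ^ 2) * sin_sq_add_cos_sq a - s ^ 2 * sin_sq_add_cos_sq b

theorem one_le_coshPolarDist (hr : 0 < r) (hs : 0 < s) (ha : 0 < sin a) (hb : 0 < sin b) :
    1 ≤ coshPolarDist r a s b := by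
  rw [coshPolarDist_eq hr hs ha hb, le_add_iff_nonneg_right]
  positivity

theorem hDist_polar (hr : 0 < r) (hs : 0 < s) (ha : 0 < sin a) (hb : 0 < sin b) :
    hDist (r * cos a, r * sin a) (s * cos b, s * sin b) = arcosh (coshPolarDist r a s b) := by
  rw [coshPolarDist_eq hr hs ha hb]
  rfl

theorem coshPolarDist_le_iff {X : ℝ} (ha : 0 < sin a) (hb : 0 < sin b) :
    coshPolarDist r a s b ≤ X ↔
      (r / s + s / r) / 2 ≤ X * sin b * sin a + cos b * cos a := by
  rw [coshPolarDist, div_le_iff₀ (mul_pos ha hb), sub_le_iff_le_add]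
  ring_nf

end Polar

theorem div_add_div_le_of_mem_Icc {E r s : ℝ} (hr : r ∈ Icc 1 E) (hs : s ∈ Icc 1 E) :
    r / s + s / r ≤ E + 1 / E := by
  obtain ⟨hr1, hrE⟩ := hr
  obtain ⟨hs1, hsE⟩ := hs
  have hr0 : 0 < r := by linarith
  have hs0 : 0 < s := by linarith
  have hE0 : 0 < E := by linarith
  rw [div_add_div _ _ hs0.ne' hr0.ne', ← sub_nonneg]
  have key : 0 ≤ (E * r - s) * (E * s - r) :=
    mul_nonneg (by nlinarith) (by nlinarith)
  have : E + 1 / E - (r * r + s * s) / (s * r) = (E * r - s) * (E * s - r) / (E * (s * r)) := by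
    field_simp
    ring
  rw [this]
  positivity

/-- A linear combination of `sin` and `cos` that is at least `M ≥ 0` at the endpoints of an interval
of length less than `π` is at least `M` on the whole interval. -/
theorem le_sin_add_cos_of_mem_Icc {M T k α β a : ℝ} (hM : 0 ≤ M) (ha : a ∈ Icc α β)
    (hαβ : α < β) (hπ : β - α < π) (hα : M ≤ T * sin α + k * cos α)
    (hβ : M ≤ T * sin β + k * cos β) : M ≤ T * sin a + k * cos a := by
  obtain ⟨h₀, h₁⟩ := ha
  have hx : 0 ≤ sin (β - a) := sin_nonneg_of_nonneg_of_le_pi (by linarith) (by linarith)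
  have hy : 0 ≤ sin (a - α) := sin_nonneg_of_nonneg_of_le_pi (by linarith) (by linarith)
  have hxy : 0 < sin (β - α) := sin_pos_of_pos_of_lt_pi (by linarith) hπ
  have hsub : sin (β - α) ≤ sin (β - a) + sin (a - α) := by
    rw [show β - α = (β - a) + (a - α) by ring, sin_add]
    nlinarith [cos_le_one (β - a), cos_le_one (a - α)]
  have hcomb : sin (β - α) * (T * sin a + k * cos a) =
      sin (β - a) * (T * sin α + k * cos α) + sin (a - α) * (T * sin β + k * cos β) := by
    simp only [sin_sub]
    ring
  refine le_of_mul_le_mul_left ?_ hxy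
  rw [hcomb]
  nlinarith [mul_le_mul_of_nonneg_left hα hx, mul_le_mul_of_nonneg_left hβ hy,
    mul_le_mul_of_nonneg_right hsub hM]

/-- The `cosh` of the hyperbolic distance between points of a closed polar rectangle is bounded by any
common bound for the corners. -/
theorem coshPolarDist_le_of_corners {E α β X r a s b : ℝ} (hα : 0 < α) (hαβ : α < β) (hβ : β < π)
    (h₀₀ : coshPolarDist 1 α E α ≤ X) (h₀₁ : coshPolarDist 1 α E β ≤ X)
    (h₁₁ : coshPolarDist E β 1 β ≤ X) (hr : r ∈ Icc 1 E) (hs : s ∈ Icc 1 E)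
    (ha : a ∈ Icc α β) (hb : b ∈ Icc α β) : coshPolarDist r a s b ≤ X := by
  have hsin : ∀ x ∈ Icc α β, 0 < sin x := fun x hx =>
    sin_pos_of_pos_of_lt_pi (by linarith [hx.1]) (by linarith [hx.2])
  have hsα := hsin α ⟨le_rfl, hαβ.le⟩
  have hsβ := hsin β ⟨hαβ.le, le_rfl⟩
  have hE : 0 < E := by linarith [hr.1, hr.2]
  have hM : 0 ≤ (E + 1 / E) / 2 := by positivity
  have hπ : β - α < π := by linarith
  rw [coshPolarDist_le_iff hsα hsα] at h₀₀
  rw [coshPolarDist_le_iff hsα hsβ] at h₀₁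
  rw [coshPolarDist_le_iff hsβ hsβ] at h₁₁
  rw [coshPolarDist_le_iff (hsin a ha) (hsin b hb)]
  have edge_α : (E + 1 / E) / 2 ≤ X * sin α * sin b + cos α * cos b :=
    le_sin_add_cos_of_mem_Icc hM hb hαβ hπ (by linarith) (by linarith)
  have edge_β : (E + 1 / E) / 2 ≤ X * sin β * sin b + cos β * cos b :=
    le_sin_add_cos_of_mem_Icc hM hb hαβ hπ (by linarith) (by linarith)
  have := le_sin_add_cos_of_mem_Icc (T := X * sin b) (k := cos b) hM ha hαβ hπ
    (by linarith) (by linarith)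
  linarith [div_add_div_le_of_mem_Icc hr hs]

theorem continuousOn_arcosh_coshPolarDist {E α β : ℝ} (hα : 0 < α) (hβ : β < π) :
    ContinuousOn (fun p : (ℝ × ℝ) × (ℝ × ℝ) => arcosh (coshPolarDist p.1.1 p.1.2 p.2.1 p.2.2))
      ((Icc 1 E ×ˢ Icc α β) ×ˢ (Icc 1 E ×ˢ Icc α β)) := by
  have hsin : ∀ x ∈ Icc α β, 0 < sin x := fun x hx =>
    sin_pos_of_pos_of_lt_pi (by linarith [hx.1]) (by linarith [hx.2])
  refine continuousOn_arcosh.comp ?_ ?_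
  · unfold coshPolarDist
    refine ContinuousOn.div ?_ (by fun_prop) ?_
    · refine ContinuousOn.sub (ContinuousOn.div_const (ContinuousOn.add ?_ ?_) _) (by fun_prop)
      · refine ContinuousOn.div (by fun_prop) (by fun_prop) ?_
        rintro p ⟨-, hs, -⟩
        exact (zero_lt_one.trans_le hs.1).ne'
      · refine ContinuousOn.div (by fun_prop) (by fun_prop) ?_
        rintro p ⟨⟨hr, -⟩, -⟩
        exact (zero_lt_one.trans_le hr.1).ne'
    · rintro p ⟨⟨-, ha⟩, -, hb⟩
      exact (mul_pos (hsin _ ha) (hsin _ hb)).ne'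
  · rintro p ⟨⟨hr, ha⟩, hs, hb⟩
    exact one_le_coshPolarDist (zero_lt_one.trans_le hr.1) (zero_lt_one.trans_le hs.1)
      (hsin _ ha) (hsin _ hb)

/-- An upper bound for the hyperbolic distances on an open polar rectangle is an upper bound on its
closure. -/
theorem arcosh_coshPolarDist_le_of_forall_Ioo {E α β d : ℝ} (hE : 1 < E) (hα : 0 < α) (hαβ : α < β)
    (hβ : β < π)
    (h : ∀ r ∈ Ioo 1 E, ∀ a ∈ Ioo α β, ∀ s ∈ Ioo 1 E, ∀ b ∈ Ioo α β,
      arcosh (coshPolarDist r a s b) ≤ d)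
    {r a s b : ℝ} (hr : r ∈ Icc 1 E) (ha : a ∈ Icc α β) (hs : s ∈ Icc 1 E) (hb : b ∈ Icc α β) :
    arcosh (coshPolarDist r a s b) ≤ d := by
  have hcl : closure ((Ioo 1 E ×ˢ Ioo α β) ×ˢ (Ioo 1 E ×ˢ Ioo α β)) =
      (Icc 1 E ×ˢ Icc α β) ×ˢ (Icc 1 E ×ˢ Icc α β) := by
    simp only [closure_prod_eq, closure_Ioo hE.ne, closure_Ioo hαβ.ne]
  refine le_on_closure (x := ((r, a), (s, b))) (g := fun _ => d)
    (f := fun p : (ℝ × ℝ) × (ℝ × ℝ) => arcosh (coshPolarDist p.1.1 p.1.2 p.2.1 p.2.2))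
    (s := (Ioo 1 E ×ˢ Ioo α β) ×ˢ (Ioo 1 E ×ˢ Ioo α β)) ?_ ?_ continuousOn_const ?_
  · rintro p ⟨⟨hr, ha⟩, hs, hb⟩
    exact h _ hr _ ha _ hs _ hb
  · rw [hcl]
    exact continuousOn_arcosh_coshPolarDist hα hβ
  · rw [hcl]
    exact ⟨⟨hr, ha⟩, hs, hb⟩

theorem diameter_eq_max_corner_distances
    (c θ0 θ1 : ℝ) (hc : 0 < c) (hθ0 : θ0 ∈ Ioo 0 (π / 2)) (hθ1 : θ1 ∈ Ioo (π / 2) π) :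
    hDiam (Omega c θ0 θ1) =
      max (hDist (Real.cos θ0, Real.sin θ0) (Real.exp (π / c) * Real.cos θ0,
            Real.exp (π / c) * Real.sin θ0))
        (max (hDist (Real.cos θ0, Real.sin θ0) (Real.exp (π / c) * Real.cos θ1,
              Real.exp (π / c) * Real.sin θ1))
          (hDist (Real.exp (π / c) * Real.cos θ1, Real.exp (π / c) * Real.sin θ1)
            (Real.cos θ1, Real.sin θ1))) := by
  obtain ⟨hα, hα'⟩ := hθ0
  obtain ⟨hβ', hβ⟩ := hθ1
  have hαβ : θ0 < θ1 := hα'.trans hβ'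
  have hE : 1 < exp (π / c) := one_lt_exp_iff.2 (div_pos pi_pos hc)
  set E := exp (π / c)
  have hsin : ∀ x ∈ Icc θ0 θ1, 0 < sin x := fun x hx =>
    sin_pos_of_pos_of_lt_pi (by linarith [hx.1]) (by linarith [hx.2])
  have m₀ : θ0 ∈ Icc θ0 θ1 := left_mem_Icc.2 hαβ.le
  have m₁ : θ1 ∈ Icc θ0 θ1 := right_mem_Icc.2 hαβ.le
  have l₀ : 1 ∈ Icc 1 E := left_mem_Icc.2 hE.le
  have l₁ : E ∈ Icc 1 E := right_mem_Icc.2 hE.le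
  have hdist : ∀ {r a s b}, r ∈ Icc 1 E → a ∈ Icc θ0 θ1 → s ∈ Icc 1 E → b ∈ Icc θ0 θ1 →
      hDist (r * cos a, r * sin a) (s * cos b, s * sin b) = arcosh (coshPolarDist r a s b) ∧
        1 ≤ coshPolarDist r a s b := fun hr ha hs hb =>
    ⟨hDist_polar (zero_lt_one.trans_le hr.1) (zero_lt_one.trans_le hs.1) (hsin _ ha) (hsin _ hb),
      one_le_coshPolarDist (zero_lt_one.trans_le hr.1) (zero_lt_one.trans_le hs.1) (hsin _ ha)
        (hsin _ hb)⟩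
  obtain ⟨e₀₀, g₀₀⟩ := hdist l₀ m₀ l₁ m₀
  obtain ⟨e₀₁, g₀₁⟩ := hdist l₀ m₀ l₁ m₁
  obtain ⟨e₁₁, g₁₁⟩ := hdist l₁ m₁ l₀ m₁
  simp only [one_mul] at e₀₀ e₀₁ e₁₁
  rw [e₀₀, e₀₁, e₁₁]
  have hlub : IsLUB {d : ℝ | ∃ p ∈ Omega c θ0 θ1, ∃ q ∈ Omega c θ0 θ1, d = hDist p q}
      (max (arcosh (coshPolarDist 1 θ0 E θ0))
        (max (arcosh (coshPolarDist 1 θ0 E θ1)) (arcosh (coshPolarDist E θ1 1 θ1)))) := by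
    constructor
    · rintro _ ⟨_, ⟨r, a, hr, hr', ha, ha', rfl⟩, _, ⟨s, b, hs, hs', hb, hb', rfl⟩, rfl⟩
      obtain ⟨e, g⟩ := hdist ⟨hr.le, hr'.le⟩ ⟨ha.le, ha'.le⟩ ⟨hs.le, hs'.le⟩ ⟨hb.le, hb'.le⟩
      rw [e]
      set D := max (arcosh (coshPolarDist 1 θ0 E θ0))
        (max (arcosh (coshPolarDist 1 θ0 E θ1)) (arcosh (coshPolarDist E θ1 1 θ1)))
      have hD : 0 ≤ D := (arcosh_nonneg g₀₀).trans (le_max_left _ _)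
      have le_cosh : ∀ {x}, 1 ≤ x → arcosh x ≤ D → x ≤ cosh D := fun {x} hx hxD => by
        rw [← cosh_arcosh hx, cosh_le_cosh, abs_of_nonneg (arcosh_nonneg hx), abs_of_nonneg hD]
        exact hxD
      rw [← arcosh_cosh hD, arcosh_le_arcosh (zero_lt_one.trans_le g) (cosh_pos D)]
      exact coshPolarDist_le_of_corners hα hαβ hβ
        (le_cosh g₀₀ (le_max_left _ _))
        (le_cosh g₀₁ ((le_max_left _ _).trans (le_max_right _ _)))
        (le_cosh g₁₁ ((le_max_right _ _).trans (le_max_right _ _)))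
        ⟨hr.le, hr'.le⟩ ⟨hs.le, hs'.le⟩ ⟨ha.le, ha'.le⟩ ⟨hb.le, hb'.le⟩
    · intro d hd
      have hd' : ∀ r ∈ Ioo 1 E, ∀ a ∈ Ioo θ0 θ1, ∀ s ∈ Ioo 1 E, ∀ b ∈ Ioo θ0 θ1,
          arcosh (coshPolarDist r a s b) ≤ d := fun r hr a ha s hs b hb =>
        hd ⟨_, ⟨r, a, hr.1, hr.2, ha.1, ha.2, rfl⟩, _, ⟨s, b, hs.1, hs.2, hb.1, hb.2, rfl⟩,
          (hdist (Ioo_subset_Icc_self hr) (Ioo_subset_Icc_self ha) (Ioo_subset_Icc_self hs)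
            (Ioo_subset_Icc_self hb)).1.symm⟩
      have hle := @arcosh_coshPolarDist_le_of_forall_Ioo E θ0 θ1 d hE hα hαβ hβ hd'
      exact max_le (hle l₀ m₀ l₁ m₀) (max_le (hle l₀ m₀ l₁ m₁) (hle l₁ m₁ l₀ m₁))
  refine hlub.csSup_eq ?_
  obtain ⟨r, hr⟩ := nonempty_Ioo.2 hE
  obtain ⟨a, ha⟩ := nonempty_Ioo.2 hαβ
  have hmem : (r * cos a, r * sin a) ∈ Omega c θ0 θ1 := ⟨r, a, hr.1, hr.2, ha.1, ha.2, rfl⟩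
  exact ⟨_, _, hmem, _, hmem, rfl⟩
end

section
/- Set a = cosh(π/c) + cos²θ* and η(θ*, c) = cos²θ* / sinh(π/c) + √(1 − sin⁴θ*) / (a + √(a² − 1)). Then the diameter D = D_{c,θ0,θ1} of Ω_{c,θ0,θ1} satisfies c² · ( 1 + (c/π)(2 ln(csc θ*) + η(θ*,c)) )^{−2} ≤ π²/D² ≤ c² · ( 1 + (c/π) ln(csc θ*) )^{−2} < c². -/
open Real Set

/-- Inverse hyperbolic cosine. -/
noncomputable def arcosh (x : ℝ) : ℝ := Real.log (x + Real.sqrt (x ^ 2 - 1))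

open Filter Topology

theorem hDist_polar_s8 {r u θ φ : ℝ} (hr : 0 < r) (hu : 0 < u) (hθ : 0 < Real.sin θ)
    (hφ : 0 < Real.sin φ) :
    hDist (r * Real.cos θ, r * Real.sin θ) (u * Real.cos φ, u * Real.sin φ) =
      Real.arcosh ((Real.cosh (Real.log (r / u)) - Real.cos θ * Real.cos φ) /
        (Real.sin θ * Real.sin φ)) := by
  have key : 1 + ((u * Real.cos φ - r * Real.cos θ) ^ 2 +
      (u * Real.sin φ - r * Real.sin θ) ^ 2) / (2 * (r * Real.sin θ) * (u * Real.sin φ)) =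
      (Real.cosh (Real.log (r / u)) - Real.cos θ * Real.cos φ) /
        (Real.sin θ * Real.sin φ) := by
    rw [Real.cosh_log (div_pos hr hu)]
    field_simp
    linear_combination r ^ 2 * Real.sin_sq_add_cos_sq θ + u ^ 2 * Real.sin_sq_add_cos_sq φ
  rw [← key]
  rfl

/-- The convexity inequality `cosh x + t sinh x ≤ cosh (x + t)`, in terms of `arcosh`. -/
theorem arcosh_cosh_add_le {x t : ℝ} (hx : 0 < x) (ht : 0 ≤ t) :
    Real.arcosh (Real.cosh x + t) ≤ x + t / Real.sinh x := by
  have hs : 0 < Real.sinh x := Real.sinh_pos_iff.2 hx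
  have hd : 0 ≤ t / Real.sinh x := div_nonneg ht hs.le
  rw [← Real.arcosh_cosh (add_nonneg hx.le hd), Real.arcosh_le_arcosh
    (add_pos_of_pos_of_nonneg (Real.cosh_pos x) ht) (Real.cosh_pos _), Real.cosh_add]
  have h1 := mul_le_mul_of_nonneg_left (Real.one_le_cosh (t / Real.sinh x)) (Real.cosh_pos x).le
  have h2 := mul_le_mul_of_nonneg_left (Real.self_le_sinh_iff.2 hd) hs.le
  rw [mul_div_cancel₀ _ hs.ne'] at h2
  linarith

theorem arcosh_div_sq_le {a s : ℝ} (ha : 1 ≤ a) (hs : 0 < s) (hs1 : s ≤ 1) :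
    Real.arcosh (a / s ^ 2) ≤ 2 * Real.log s⁻¹ + Real.arcosh a +
      Real.sqrt (1 - s ^ 4) / (a + Real.sqrt (a ^ 2 - 1)) := by
  set P := a + Real.sqrt (a ^ 2 - 1) with hP
  set Q := Real.sqrt (1 - s ^ 4) with hQ
  have hPpos : 0 < P := by positivity
  have hs4 : s ^ 4 ≤ 1 := pow_le_one₀ hs.le hs1
  have hsub : Real.sqrt (a ^ 2 - s ^ 4) ≤ Real.sqrt (a ^ 2 - 1) + Q := by
    rw [Real.sqrt_le_iff]
    refine ⟨by positivity, ?_⟩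
    have h1 := Real.sq_sqrt (show 0 ≤ a ^ 2 - 1 by nlinarith)
    have h2 := Real.sq_sqrt (show 0 ≤ 1 - s ^ 4 by linarith)
    nlinarith [mul_nonneg (Real.sqrt_nonneg (a ^ 2 - 1)) (Real.sqrt_nonneg (1 - s ^ 4))]
  have hscale : a / s ^ 2 + Real.sqrt ((a / s ^ 2) ^ 2 - 1) =
      (s⁻¹) ^ 2 * (a + Real.sqrt (a ^ 2 - s ^ 4)) := by
    rw [show (a / s ^ 2) ^ 2 - 1 = (a ^ 2 - s ^ 4) / (s ^ 2) ^ 2 by field_simp,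
      Real.sqrt_div' _ (by positivity), Real.sqrt_sq (by positivity)]
    field_simp
  have hle : a + Real.sqrt (a ^ 2 - s ^ 4) ≤ P * Real.exp (Q / P) := by
    have h := mul_le_mul_of_nonneg_left (Real.add_one_le_exp (Q / P)) hPpos.le
    rw [mul_add, mul_div_cancel₀ _ hPpos.ne'] at h
    linarith
  rw [Real.arcosh, hscale, Real.log_mul (by positivity) (by positivity), Real.log_pow]
  have h := Real.log_le_log (by positivity) hle
  rw [Real.log_mul hPpos.ne' (Real.exp_ne_zero _), Real.log_exp] at h
  have : Real.arcosh a = Real.log P := rfl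
  push_cast
  linarith

theorem sin_le_sin_and_abs_cos_le {θ0 θ1 θ : ℝ} (hθ0 : θ0 ∈ Ioo 0 (π / 2))
    (hθ1 : θ1 ∈ Ioo (π / 2) π) (h0 : θ0 < θ) (h1 : θ < θ1) :
    Real.sin (min θ0 (π - θ1)) ≤ Real.sin θ ∧ |Real.cos θ| ≤ Real.cos (min θ0 (π - θ1)) := by
  have hm0 := min_le_left θ0 (π - θ1)
  have hm1 := min_le_right θ0 (π - θ1)
  have hpos : 0 < min θ0 (π - θ1) := lt_min hθ0.1 (by linarith [hθ1.2])
  obtain ⟨a1, a2⟩ := hθ0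
  obtain ⟨b1, b2⟩ := hθ1
  set m := min θ0 (π - θ1)
  have hc : |Real.cos θ| ≤ Real.cos m := by
    rw [abs_le]
    constructor
    · rw [← Real.cos_pi_sub]
      exact Real.cos_le_cos_of_nonneg_of_le_pi (by linarith) (by linarith) (by linarith)
    · exact Real.cos_le_cos_of_nonneg_of_le_pi (by linarith) (by linarith) (by linarith)
  refine ⟨?_, hc⟩
  have hs : 0 ≤ Real.sin θ := Real.sin_nonneg_of_nonneg_of_le_pi (by linarith) (by linarith)
  refine le_of_sq_le_sq ?_ hs
  have := pow_le_pow_left₀ (abs_nonneg _) hc 2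
  rw [sq_abs] at this
  nlinarith [Real.sin_sq_add_cos_sq θ, Real.sin_sq_add_cos_sq m]

theorem hDist_le_of_mem_Omega {c θ0 θ1 : ℝ} (hθ0 : θ0 ∈ Ioo 0 (π / 2))
    (hθ1 : θ1 ∈ Ioo (π / 2) π) {p q : ℝ × ℝ} (hp : p ∈ Omega c θ0 θ1) (hq : q ∈ Omega c θ0 θ1) :
    hDist p q ≤ Real.arcosh ((Real.cosh (π / c) + Real.cos (min θ0 (π - θ1)) ^ 2) /
      Real.sin (min θ0 (π - θ1)) ^ 2) := by
  obtain ⟨r, θ, hr1, hr2, hθa, hθb, rfl⟩ := hp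
  obtain ⟨u, φ, hu1, hu2, hφa, hφb, rfl⟩ := hq
  have hr : 0 < r := by linarith
  have hu : 0 < u := by linarith
  obtain ⟨hsθ, hcθ⟩ := sin_le_sin_and_abs_cos_le hθ0 hθ1 hθa hθb
  obtain ⟨hsφ, hcφ⟩ := sin_le_sin_and_abs_cos_le hθ0 hθ1 hφa hφb
  have hm0 := min_le_left θ0 (π - θ1)
  have hmpos : 0 < min θ0 (π - θ1) := lt_min hθ0.1 (by linarith [hθ1.2])
  have hspos : 0 < Real.sin (min θ0 (π - θ1)) :=
    Real.sin_pos_of_pos_of_lt_pi hmpos (by linarith [hθ0.2, Real.pi_pos])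
  set m := min θ0 (π - θ1)
  have hsθ' := hspos.trans_le hsθ
  have hsφ' := hspos.trans_le hsφ
  have hcosh : Real.cosh (Real.log (r / u)) ≤ Real.cosh (π / c) := by
    have h1 := Real.log_pos hr1
    have h2 := Real.log_pos hu1
    have h3 := (Real.log_lt_iff_lt_exp hr).2 hr2
    have h4 := (Real.log_lt_iff_lt_exp hu).2 hu2
    rw [Real.cosh_le_cosh, Real.log_div hr.ne' hu.ne']
    exact (abs_le.2 ⟨by linarith, by linarith⟩ : _ ≤ π / c).trans (le_abs_self _)
  have hcc : |Real.cos θ * Real.cos φ| ≤ Real.cos m ^ 2 := by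
    rw [abs_mul, sq]
    exact mul_le_mul hcθ hcφ (abs_nonneg _) ((abs_nonneg _).trans hcθ)
  have hnum : 0 < Real.cosh (Real.log (r / u)) - Real.cos θ * Real.cos φ := by
    have h1 := Real.one_le_cosh (Real.log (r / u))
    have h2 := (abs_le.1 hcc).2
    nlinarith [Real.sin_sq_add_cos_sq m]
  rw [hDist_polar_s8 hr hu hsθ' hsφ', Real.arcosh_le_arcosh (by positivity) (by positivity),
    sq (Real.sin m)]
  have h2 := (abs_le.1 hcc).1
  gcongr
  linarith

theorem exists_mem_Ioo_sin_eq {θ0 θ1 t : ℝ} (hθ0 : θ0 ∈ Ioo 0 (π / 2))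
    (hθ1 : θ1 ∈ Ioo (π / 2) π) (ht : 0 < t) (ht' : min θ0 (π - θ1) + t < π / 2) :
    ∃ θ ∈ Ioo θ0 θ1, Real.sin θ = Real.sin (min θ0 (π - θ1) + t) := by
  obtain ⟨a1, a2⟩ := hθ0
  obtain ⟨b1, b2⟩ := hθ1
  rcases min_choice θ0 (π - θ1) with h | h
  · rw [h] at ht' ⊢
    exact ⟨θ0 + t, ⟨by linarith, by linarith⟩, rfl⟩
  · rw [h] at ht' ⊢
    refine ⟨θ1 - t, ⟨by linarith, by linarith⟩, ?_⟩
    rw [← Real.sin_pi_sub]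
    ring_nf

theorem bddAbove_hDist_Omega {c θ0 θ1 : ℝ} (hθ0 : θ0 ∈ Ioo 0 (π / 2))
    (hθ1 : θ1 ∈ Ioo (π / 2) π) :
    BddAbove {d : ℝ | ∃ p ∈ Omega c θ0 θ1, ∃ q ∈ Omega c θ0 θ1, d = hDist p q} := by
  exact ⟨Real.arcosh ((Real.cosh (π / c) + Real.cos (min θ0 (π - θ1)) ^ 2) /
    Real.sin (min θ0 (π - θ1)) ^ 2), fun _ ⟨_, hp, _, hq, hd⟩ =>
      hd ▸ hDist_le_of_mem_Omega hθ0 hθ1 hp hq⟩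

theorem arcosh_le_hDiam_Omega {c θ0 θ1 t : ℝ} (hθ0 : θ0 ∈ Ioo 0 (π / 2))
    (hθ1 : θ1 ∈ Ioo (π / 2) π) (ht : 0 < t) (htc : t < π / c)
    (ht' : min θ0 (π - θ1) + t < π / 2) :
    Real.arcosh (Real.cosh (π / c - 2 * t) / Real.sin (min θ0 (π - θ1) + t)) ≤
      hDiam (Omega c θ0 θ1) := by
  obtain ⟨θ, ⟨h0, h1⟩, hs⟩ := exists_mem_Ioo_sin_eq hθ0 hθ1 ht ht'
  have hsin : 0 < Real.sin θ :=
    Real.sin_pos_of_pos_of_lt_pi (by linarith [hθ0.1]) (by linarith [hθ1.2])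
  refine le_csSup (bddAbove_hDist_Omega hθ0 hθ1)
    ⟨_, ⟨Real.exp (π / c - t), π / 2, Real.one_lt_exp_iff.2 (by linarith),
      Real.exp_lt_exp.2 (by linarith), hθ0.2, hθ1.1, rfl⟩,
      _, ⟨Real.exp t, θ, Real.one_lt_exp_iff.2 ht, Real.exp_lt_exp.2 htc, h0, h1, rfl⟩, ?_⟩
  rw [hDist_polar_s8 (Real.exp_pos _) (Real.exp_pos _) (by simp) hsin, ← Real.exp_sub, Real.log_exp,
    hs]
  simp only [Real.sin_pi_div_two, Real.cos_pi_div_two]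
  ring_nf

theorem cosh_div_sin_le_cosh_hDiam_Omega {c θ0 θ1 : ℝ} (hc : 0 < c) (hθ0 : θ0 ∈ Ioo 0 (π / 2))
    (hθ1 : θ1 ∈ Ioo (π / 2) π) :
    0 ≤ hDiam (Omega c θ0 θ1) ∧
    Real.cosh (π / c) / Real.sin (min θ0 (π - θ1)) ≤ Real.cosh (hDiam (Omega c θ0 θ1)) := by
  have hℓ : 0 < π / c := div_pos Real.pi_pos hc
  have hm0 : min θ0 (π - θ1) < π / 2 := (min_le_left _ _).trans_lt hθ0.2
  have hmpos : 0 < min θ0 (π - θ1) := lt_min hθ0.1 (by linarith [hθ1.2])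
  have hspos : 0 < Real.sin (min θ0 (π - θ1)) :=
    Real.sin_pos_of_pos_of_lt_pi hmpos (by linarith [Real.pi_pos])
  have hev : ∀ᶠ t in 𝓝[>] (0 : ℝ), 0 ≤ hDiam (Omega c θ0 θ1) ∧
      Real.cosh (π / c - 2 * t) / Real.sin (min θ0 (π - θ1) + t) ≤
        Real.cosh (hDiam (Omega c θ0 θ1)) := by
    filter_upwards [Ioo_mem_nhdsGT (lt_min hℓ (sub_pos.2 hm0))] with t ht
    have ht1 := ht.2.trans_le (min_le_left _ _)
    have ht2 := ht.2.trans_le (min_le_right _ _)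
    have h := arcosh_le_hDiam_Omega hθ0 hθ1 ht.1 ht1 (by linarith)
    have hs : 0 < Real.sin (min θ0 (π - θ1) + t) :=
      Real.sin_pos_of_pos_of_lt_pi (by linarith [ht.1]) (by linarith [Real.pi_pos])
    have hx : 1 ≤ Real.cosh (π / c - 2 * t) / Real.sin (min θ0 (π - θ1) + t) := by
      rw [one_le_div hs]
      exact (Real.sin_le_one _).trans (Real.one_le_cosh _)
    have hn := Real.arcosh_nonneg hx
    refine ⟨hn.trans h, ?_⟩
    rw [← Real.cosh_arcosh hx, Real.cosh_le_cosh]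
    exact abs_le_abs_of_nonneg hn h
  refine ⟨hev.exists.choose_spec.1, ?_⟩
  have hcont : ContinuousAt
      (fun t => Real.cosh (π / c - 2 * t) / Real.sin (min θ0 (π - θ1) + t)) 0 := by
    refine ContinuousAt.div (by fun_prop) (by fun_prop) ?_
    simpa using hspos.ne'
  have hlim := hcont.tendsto.mono_left (nhdsWithin_le_nhds (s := Ioi (0 : ℝ)))
  simp only [mul_zero, sub_zero, add_zero] at hlim
  exact le_of_tendsto hlim (hev.mono fun _ h => h.2)

theorem pi_div_add_log_le_hDiam_Omega {c θ0 θ1 : ℝ} (hc : 0 < c) (hθ0 : θ0 ∈ Ioo 0 (π / 2))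
    (hθ1 : θ1 ∈ Ioo (π / 2) π) :
    π / c + Real.log (Real.sin (min θ0 (π - θ1)))⁻¹ ≤ hDiam (Omega c θ0 θ1) := by
  obtain ⟨hD, h⟩ := cosh_div_sin_le_cosh_hDiam_Omega hc hθ0 hθ1
  have hm0 : min θ0 (π - θ1) < π / 2 := (min_le_left _ _).trans_lt hθ0.2
  have hmpos : 0 < min θ0 (π - θ1) := lt_min hθ0.1 (by linarith [hθ1.2])
  have hspos : 0 < Real.sin (min θ0 (π - θ1)) :=
    Real.sin_pos_of_pos_of_lt_pi hmpos (by linarith [Real.pi_pos])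
  have hs1 := Real.sin_le_one (min θ0 (π - θ1))
  set s := Real.sin (min θ0 (π - θ1))
  have hle : Real.cosh (π / c + Real.log s⁻¹) ≤ Real.cosh (π / c) / s := by
    rw [Real.cosh_eq, Real.cosh_eq, neg_add, Real.exp_add, Real.exp_add, Real.exp_neg (Real.log _),
      Real.exp_log (inv_pos.2 hspos), inv_inv]
    have hi : s ≤ s⁻¹ := hs1.trans ((one_le_inv₀ hspos).2 hs1)
    have := mul_le_mul_of_nonneg_left hi (Real.exp_pos (-(π / c))).le
    rw [div_eq_mul_inv _ s]
    linarith
  have := Real.cosh_le_cosh.1 (hle.trans h)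
  rw [abs_of_nonneg hD] at this
  exact (le_abs_self _).trans this

theorem diameter_explicit_estimate
    (c θ0 θ1 : ℝ) (hc : 0 < c) (hθ0 : θ0 ∈ Ioo 0 (π / 2)) (hθ1 : θ1 ∈ Ioo (π / 2) π) :
    let θs := min θ0 (π - θ1)
    let a := Real.cosh (π / c) + Real.cos θs ^ 2
    let η := Real.cos θs ^ 2 / Real.sinh (π / c) +
      Real.sqrt (1 - Real.sin θs ^ 4) / (a + Real.sqrt (a ^ 2 - 1))
    let D := hDiam (Omega c θ0 θ1)
    c ^ 2 * (1 + c / π * (2 * Real.log ((Real.sin θs)⁻¹) + η)) ^ (-2 : ℤ) ≤ π ^ 2 / D ^ 2 ∧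
      π ^ 2 / D ^ 2 ≤ c ^ 2 * (1 + c / π * Real.log ((Real.sin θs)⁻¹)) ^ (-2 : ℤ) ∧
      c ^ 2 * (1 + c / π * Real.log ((Real.sin θs)⁻¹)) ^ (-2 : ℤ) < c ^ 2 := by
  intro θs a η D
  have hℓ : 0 < π / c := div_pos Real.pi_pos hc
  have hm0 : θs < π / 2 := (min_le_left _ _).trans_lt hθ0.2
  have hmpos : 0 < θs := lt_min hθ0.1 (by linarith [hθ1.2])
  have hspos : 0 < Real.sin θs :=
    Real.sin_pos_of_pos_of_lt_pi hmpos (by linarith [Real.pi_pos])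
  have hs1 : Real.sin θs < 1 := by
    rw [← Real.sin_pi_div_two]
    exact Real.sin_lt_sin_of_lt_of_le_pi_div_two (by linarith) le_rfl hm0
  have hL : 0 < Real.log (Real.sin θs)⁻¹ := Real.log_pos ((one_lt_inv₀ hspos).2 hs1)
  have hlow : π / c + Real.log (Real.sin θs)⁻¹ ≤ D := pi_div_add_log_le_hDiam_Omega hc hθ0 hθ1
  have hD : 0 < D := by linarith
  have hup : D ≤ π / c + (2 * Real.log (Real.sin θs)⁻¹ + η) := by
    have h1 : D ≤ Real.arcosh (a / Real.sin θs ^ 2) := by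
      refine Real.sSup_le ?_ ?_
      · rintro d ⟨p, hp, q, hq, rfl⟩
        exact hDist_le_of_mem_Omega hθ0 hθ1 hp hq
      · refine Real.arcosh_nonneg ?_
        rw [one_le_div (by positivity)]
        nlinarith [Real.one_le_cosh (π / c), sq_nonneg (Real.cos θs)]
    have ha : 1 ≤ a := le_add_of_le_of_nonneg (Real.one_le_cosh _) (sq_nonneg _)
    have h2 := arcosh_div_sq_le ha hspos hs1.le
    have h3 : Real.arcosh a ≤ _ := arcosh_cosh_add_le hℓ (sq_nonneg (Real.cos θs))
    change D ≤ π / c + (2 * Real.log (Real.sin θs)⁻¹ + (_ + _))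
    linarith
  have hscale (x : ℝ) : c ^ 2 * (1 + c / π * x) ^ (-2 : ℤ) = π ^ 2 / (π / c + x) ^ 2 := by
    have : 1 + c / π * x = (c / π) * (π / c + x) := by
      field_simp
    rw [this, zpow_neg, zpow_ofNat, mul_pow, div_pow]
    by_cases hx : π / c + x = 0
    · simp [hx]
    · field_simp
  rw [hscale, hscale]
  refine ⟨by gcongr, by gcongr, ?_⟩
  calc π ^ 2 / (π / c + Real.log (Real.sin θs)⁻¹) ^ 2 < π ^ 2 / (π / c) ^ 2 := by
        gcongr
        linarith
    _ = c ^ 2 := by field_simp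
end

section
/- For fixed θ0 ∈ (0, π/2) and θ1 ∈ (π/2, π), the quantity π² / ( c² · D_{c,θ0,θ1}² ) tends to 1 as c → 0⁺. Moreover, for fixed c > 0, π² / ( c² · D_{c,θ0,θ1}² ) tends to 1 as θ* = min(θ0, π − θ1) → π/2 (i.e. as θ0 → π/2⁻ and θ1 → π/2⁺). -/
open Real Set

theorem sin_min_le {θ0 θ1 θ : ℝ} (h0 : 0 < θ0) (h1 : θ1 < π) (hl : θ0 < θ) (hr : θ < θ1) :
    min (sin θ0) (sin θ1) ≤ sin θ :=
  strictConcaveOn_sin_Icc.concaveOn.min_le_of_mem_Icc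
    ⟨h0.le, by linarith⟩ ⟨by linarith, h1.le⟩ ⟨hl.le, hr.le⟩

/-- The angular excess in the upper bound for the diameter, as a function of `m`, a lower bound for
the sines of the angles involved. -/
noncomputable def angularExcess (m : ℝ) : ℝ := Real.arcosh ((2 - m ^ 2) / m ^ 2)

theorem one_le_excess_ratio {m : ℝ} (hm : 0 < m) (hm1 : m ≤ 1) : 1 ≤ (2 - m ^ 2) / m ^ 2 := by
  rw [le_div_iff₀ (by positivity)]
  nlinarith

theorem angularExcess_nonneg {m : ℝ} (hm : 0 < m) (hm1 : m ≤ 1) : 0 ≤ angularExcess m :=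
  Real.arcosh_nonneg (one_le_excess_ratio hm hm1)

theorem hDist_eq_arcosh (p q : ℝ × ℝ) :
    hDist p q = Real.arcosh (1 + ((q.1 - p.1) ^ 2 + (q.2 - p.2) ^ 2) / (2 * p.2 * q.2)) := rfl

/-- The hyperbolic law of cosines in logarithmic polar coordinates. -/
theorem hDist_polar_s9 (a b θ φ : ℝ) (hθ : 0 < sin θ) (hφ : 0 < sin φ) :
    hDist (exp a * cos θ, exp a * sin θ) (exp b * cos φ, exp b * sin φ) =
      Real.arcosh ((cosh (b - a) - cos θ * cos φ) / (sin θ * sin φ)) := by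
  rw [hDist_eq_arcosh]
  congr 1
  have ha := exp_pos a
  have hb := exp_pos b
  rw [cosh_eq, neg_sub, exp_sub, exp_sub]
  field_simp
  linear_combination (exp b ^ 2) * sin_sq_add_cos_sq φ + (exp a ^ 2) * sin_sq_add_cos_sq θ

theorem hDist_le {T θ0 θ1 m : ℝ} (hT : 0 ≤ T) (hm : 0 < m) (hm1 : m ≤ 1)
    (hsin : ∀ θ, θ0 < θ → θ < θ1 → m ≤ sin θ) {a b θ φ : ℝ}
    (ha : a ∈ Ioo 0 T) (hb : b ∈ Ioo 0 T) (hθ : θ ∈ Ioo θ0 θ1) (hφ : φ ∈ Ioo θ0 θ1) :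
    hDist (exp a * cos θ, exp a * sin θ) (exp b * cos φ, exp b * sin φ) ≤
      T + angularExcess m := by
  have h1 := hsin θ hθ.1 hθ.2
  have h2 := hsin φ hφ.1 hφ.2
  have hs := angularExcess_nonneg hm hm1
  have hSS : 0 < sin θ * sin φ := mul_pos (by linarith) (by linarith)
  rw [hDist_polar_s9 a b θ φ (by linarith) (by linarith), ← Real.arcosh_cosh (add_nonneg hT hs)]
  have hc1 : 1 ≤ cosh (b - a) := one_le_cosh _
  have hcT : cosh (b - a) ≤ cosh T := by
    rw [cosh_le_cosh, abs_of_nonneg hT, abs_le]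
    constructor <;> linarith [ha.1, ha.2, hb.1, hb.2]
  have hcos_lt : cos θ * cos φ < 1 := by
    nlinarith [sq_nonneg (cos θ - cos φ), sin_sq_add_cos_sq θ, sin_sq_add_cos_sq φ]
  rw [Real.arcosh_le_arcosh (div_pos (by linarith) hSS) (cosh_pos _)]
  calc (cosh (b - a) - cos θ * cos φ) / (sin θ * sin φ)
      ≤ cosh T * ((2 - m ^ 2) / m ^ 2) := by
        rw [← mul_div_assoc]
        have hneg : -(cos θ * cos φ) ≤ 1 - m ^ 2 := by
          nlinarith [sq_nonneg (cos θ + cos φ), sin_sq_add_cos_sq θ, sin_sq_add_cos_sq φ]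
        apply div_le_div₀
        · exact mul_nonneg (cosh_pos _).le (by nlinarith)
        · nlinarith [mul_nonneg (sub_nonneg.2 (hc1.trans hcT)) (show 0 ≤ 1 - m ^ 2 by nlinarith)]
        · positivity
        · nlinarith
    _ = cosh T * cosh (angularExcess m) := by
        rw [angularExcess, Real.cosh_arcosh (one_le_excess_ratio hm hm1)]
    _ ≤ cosh (T + angularExcess m) := by
        rw [cosh_add]
        have := mul_nonneg (sinh_nonneg_iff.2 hT) (sinh_nonneg_iff.2 hs)
        linarith

theorem hDiam_bounds {c θ0 θ1 : ℝ} (hc : 0 < c) (hθ0 : θ0 ∈ Ioo 0 (π / 2))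
    (hθ1 : θ1 ∈ Ioo (π / 2) π) :
    π / c ≤ hDiam (Omega c θ0 θ1) ∧
      hDiam (Omega c θ0 θ1) ≤ π / c + angularExcess (min (sin θ0) (sin θ1)) := by
  set m := min (sin θ0) (sin θ1)
  have hT : 0 < π / c := by positivity
  have hm : 0 < m := lt_min (sin_pos_of_pos_of_lt_pi hθ0.1 (by linarith [hθ0.2, pi_pos]))
    (sin_pos_of_pos_of_lt_pi (by linarith [hθ1.1, pi_pos]) hθ1.2)
  have hm1 : m ≤ 1 := (min_le_left _ _).trans (sin_le_one _)
  have hub : ∀ d ∈ {d : ℝ | ∃ p ∈ Omega c θ0 θ1, ∃ q ∈ Omega c θ0 θ1, d = hDist p q},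
      d ≤ π / c + angularExcess m := by
    rintro d ⟨p, ⟨r, θ, hr, hr', hθ, hθ', rfl⟩, q, ⟨s, φ, hs, hs', hφ, hφ', rfl⟩, rfl⟩
    have h := hDist_le hT.le hm hm1 (fun θ h h' => sin_min_le hθ0.1 hθ1.2 h h')
      (a := Real.log r) (b := Real.log s)
      ⟨log_pos hr, (log_lt_iff_lt_exp (by linarith)).2 hr'⟩
      ⟨log_pos hs, (log_lt_iff_lt_exp (by linarith)).2 hs'⟩ ⟨hθ, hθ'⟩ ⟨hφ, hφ'⟩
    rwa [exp_log (by linarith), exp_log (by linarith)] at h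
  have hlow : ∀ a, 0 < a → a < π / c / 2 → π / c - 2 * a ≤ hDiam (Omega c θ0 θ1) := by
    intro a ha ha'
    refine le_csSup ⟨_, hub⟩ ⟨(exp a * cos (π / 2), exp a * sin (π / 2)),
      ⟨_, _, one_lt_exp_iff.2 ha, exp_lt_exp.2 (by linarith), hθ0.2, hθ1.1, rfl⟩,
      (exp (π / c - a) * cos (π / 2), exp (π / c - a) * sin (π / 2)),
      ⟨_, _, one_lt_exp_iff.2 (by linarith), exp_lt_exp.2 (by linarith), hθ0.2, hθ1.1, rfl⟩, ?_⟩
    rw [hDist_polar_s9 _ _ _ _ (by simp) (by simp)]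
    simp only [cos_pi_div_two, sin_pi_div_two, mul_zero, sub_zero, mul_one, div_one]
    rw [Real.arcosh_cosh (by linarith)]
    ring
  constructor
  · refine le_of_forall_pos_lt_add fun ε hε => ?_
    have h := hlow (min (ε / 4) (π / c / 4)) (by positivity)
      (by linarith [min_le_right (ε / 4) (π / c / 4)])
    linarith [min_le_left (ε / 4) (π / c / 4)]
  · refine csSup_le ?_ hub
    have hmem : (exp (π / c / 2) * cos (π / 2), exp (π / c / 2) * sin (π / 2)) ∈
        Omega c θ0 θ1 :=
      ⟨_, _, one_lt_exp_iff.2 (by linarith), exp_lt_exp.2 (by linarith), hθ0.2, hθ1.1, rfl⟩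
    exact ⟨_, _, hmem, _, hmem, rfl⟩

theorem diameter_ratio_bounds {c θ0 θ1 : ℝ} (hc : 0 < c) (hθ0 : θ0 ∈ Ioo 0 (π / 2))
    (hθ1 : θ1 ∈ Ioo (π / 2) π) :
    π ^ 2 / (π + c * angularExcess (min (sin θ0) (sin θ1))) ^ 2 ≤
        π ^ 2 / (c ^ 2 * (hDiam (Omega c θ0 θ1)) ^ 2) ∧
      π ^ 2 / (c ^ 2 * (hDiam (Omega c θ0 θ1)) ^ 2) ≤ 1 := by
  obtain ⟨h1, h2⟩ := hDiam_bounds hc hθ0 hθ1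
  rw [← mul_pow]
  have h1' : π ≤ c * hDiam (Omega c θ0 θ1) := by
    rwa [div_le_iff₀' hc] at h1
  have h2' : c * hDiam (Omega c θ0 θ1) ≤
      π + c * angularExcess (min (sin θ0) (sin θ1)) := by
    have := mul_le_mul_of_nonneg_left h2 hc.le
    rwa [mul_add, mul_div_cancel₀ _ hc.ne'] at this
  have hpos : 0 < c * hDiam (Omega c θ0 θ1) := pi_pos.trans_le h1'
  constructor
  · gcongr
  · rw [div_le_one (by positivity)]
    gcongr

theorem tendsto_angularExcess :
    Filter.Tendsto (fun p : ℝ × ℝ => angularExcess (min (sin p.1) (sin p.2)))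
      ((nhdsWithin (π / 2) (Iio (π / 2))) ×ˢ (nhdsWithin (π / 2) (Ioi (π / 2)))) (nhds 0) := by
  set l := (nhdsWithin (π / 2) (Iio (π / 2))) ×ˢ (nhdsWithin (π / 2) (Ioi (π / 2)))
  have hl : l ≤ nhds (π / 2, π / 2) := by
    rw [nhds_prod_eq]
    exact Filter.prod_mono nhdsWithin_le_nhds nhdsWithin_le_nhds
  have hm : Filter.Tendsto (fun p : ℝ × ℝ => min (sin p.1) (sin p.2)) l (nhds 1) :=
    (Continuous.tendsto' (by fun_prop) _ _ (by simp)).mono_left hl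
  have hq : Filter.Tendsto (fun m : ℝ => (2 - m ^ 2) / m ^ 2) (nhds 1) (nhds 1) := by
    have : ContinuousAt (fun m : ℝ => (2 - m ^ 2) / m ^ 2) 1 :=
      ContinuousAt.div (by fun_prop) (by fun_prop) (by simp)
    convert this.tendsto using 2
    norm_num
  have hr : Filter.Tendsto Real.arcosh (nhdsWithin 1 (Ici 1)) (nhds 0) := by
    simpa using (Real.continuousOn_arcosh 1 self_mem_Ici).tendsto
  refine hr.comp (tendsto_nhdsWithin_iff.2 ⟨hq.comp hm, ?_⟩)
  filter_upwards [hm.eventually (lt_mem_nhds one_pos)] with p hp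
  exact one_le_excess_ratio hp ((min_le_left _ _).trans (sin_le_one _))

theorem diameter_limit
    (θ0 θ1 : ℝ) (hθ0 : θ0 ∈ Ioo 0 (π / 2)) (hθ1 : θ1 ∈ Ioo (π / 2) π) :
    Filter.Tendsto (fun c : ℝ => π ^ 2 / (c ^ 2 * (hDiam (Omega c θ0 θ1)) ^ 2))
      (nhdsWithin 0 (Ioi 0)) (nhds 1) ∧
    ∀ c : ℝ, 0 < c →
      Filter.Tendsto
        (fun p : ℝ × ℝ => π ^ 2 / (c ^ 2 * (hDiam (Omega c p.1 p.2)) ^ 2))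
        ((nhdsWithin (π / 2) (Iio (π / 2))) ×ˢ (nhdsWithin (π / 2) (Ioi (π / 2))))
        (nhds 1) := by
  have hlim : Filter.Tendsto (fun x : ℝ => π ^ 2 / (π + x) ^ 2) (nhds 0) (nhds 1) := by
    have : ContinuousAt (fun x : ℝ => π ^ 2 / (π + x) ^ 2) 0 := by
      refine ContinuousAt.div (by fun_prop) (by fun_prop) ?_
      simp [pi_ne_zero]
    simpa [ContinuousAt, pi_ne_zero] using this
  constructor
  · have hx : Filter.Tendsto (fun c : ℝ => c * angularExcess (min (sin θ0) (sin θ1)))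
        (nhdsWithin 0 (Ioi 0)) (nhds 0) := by
      refine Filter.Tendsto.mono_left ?_ nhdsWithin_le_nhds
      exact Continuous.tendsto' (by fun_prop) _ _ (by simp)
    refine tendsto_of_tendsto_of_tendsto_of_le_of_le' (hlim.comp hx) tendsto_const_nhds ?_ ?_
    · filter_upwards [self_mem_nhdsWithin] with c hc
      exact (diameter_ratio_bounds hc hθ0 hθ1).1
    · filter_upwards [self_mem_nhdsWithin] with c hc
      exact (diameter_ratio_bounds hc hθ0 hθ1).2
  · intro c hc
    have hx := tendsto_angularExcess.const_mul c
    rw [mul_zero] at hx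
    have hmem : ∀ᶠ p : ℝ × ℝ in
        (nhdsWithin (π / 2) (Iio (π / 2))) ×ˢ (nhdsWithin (π / 2) (Ioi (π / 2))),
        p.1 ∈ Ioo 0 (π / 2) ∧ p.2 ∈ Ioo (π / 2) π :=
      Filter.prod_mem_prod (Ioo_mem_nhdsLT (by positivity)) (Ioo_mem_nhdsGT (by linarith [pi_pos]))
    refine tendsto_of_tendsto_of_tendsto_of_le_of_le' (hlim.comp hx) tendsto_const_nhds ?_ ?_
    · filter_upwards [hmem] with p hp
      exact (diameter_ratio_bounds hc hp.1 hp.2).1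
    · filter_upwards [hmem] with p hp
      exact (diameter_ratio_bounds hc hp.1 hp.2).2
end
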